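/- arXiv:2404.12160 — 2 statements merged into one kernel-verified Lean document; each statement's English description precedes it below -/
import Mathlib

section
/- Let W and T be real symmetric positive semi-definite n×n matrices, and let A = W + iT (as a complex matrix). If A is nonsingular, then M = W + T is symmetric positive definite. -/
theorem stmt_1 {n : ℕ} (W T : Matrix (Fin n) (Fin n) ℝ)
    (hW : W.PosSemidef) (hT : T.PosSemidef)
    (A : Matrix (Fin n) (Fin n) ℂ)
    (hA : A = W.map Complex.ofReal + Complex.I • T.map Complex.ofReal)
    (hinv : IsUnit A) : (W + T).PosDef := by
  refine Matrix.PosDef.of_dotProduct_mulVec_pos (hW.add hT).isHermitian ?_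
  intro x hx
  have h1 := hW.dotProduct_mulVec_nonneg x
  have h2 := hT.dotProduct_mulVec_nonneg x
  rw [Matrix.add_mulVec, dotProduct_add]
  by_contra hneg
  have e1 : W.mulVec x = 0 := (hW.dotProduct_mulVec_zero_iff x).1 (by linarith)
  have e2 : T.mulVec x = 0 := (hT.dotProduct_mulVec_zero_iff x).1 (by linarith)
  have key : ∀ B : Matrix (Fin n) (Fin n) ℝ, B.mulVec x = 0 →
      (B.map Complex.ofReal).mulVec (fun i => (x i : ℂ)) = 0 := by
    intro B hB
    ext i
    have := congrFun hB i
    simp only [Matrix.mulVec, dotProduct, Matrix.map_apply, Pi.zero_apply] at this ⊢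
    exact_mod_cast this
  have hA0 : A.mulVec (fun i => (x i : ℂ)) = 0 := by
    rw [hA, Matrix.add_mulVec, Matrix.smul_mulVec, key W e1, key T e2]
    simp
  have hx0 : (fun i => (x i : ℂ)) = 0 :=
    Matrix.mulVec_injective_iff_isUnit.2 hinv (by rw [hA0, Matrix.mulVec_zero])
  apply hx
  ext i
  have := congrFun hx0 i
  simpa using this
end

section
/- Let W, T ∈ ℝ^{n×n} with W symmetric positive definite, T symmetric positive semi-definite, A = W + iT, α > 0 and 0 ≤ ω < 2. Define the GADI iteration matrix M(α,ω) = (αI + iT)⁻¹(αI + W)⁻¹[α²I + iWT − (1−ω)αA] and the HSS iteration matrix T(α) = (αI + iT)⁻¹(αI − W)(αI + W)⁻¹(αI − iT). Then M(α,ω) = (1/2)[(2 − ω) T(α) + ω I]. -/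
theorem stmt_9 {n : ℕ} (W T : Matrix (Fin n) (Fin n) ℝ)
    (hW : W.PosDef) (hT : T.PosSemidef)
    (α ω : ℝ) (hα : 0 < α) (hω : 0 ≤ ω) (hω2 : ω < 2)
    (Wc Tc A : Matrix (Fin n) (Fin n) ℂ)
    (hWc : Wc = W.map Complex.ofReal) (hTc : Tc = T.map Complex.ofReal)
    (hA : A = Wc + Complex.I • Tc) :
    ((α : ℂ) • 1 + Complex.I • Tc)⁻¹ * ((α : ℂ) • 1 + Wc)⁻¹ *
        ((α : ℂ) ^ 2 • (1 : Matrix (Fin n) (Fin n) ℂ) + Complex.I • (Wc * Tc)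
          - (((1 - ω : ℝ) : ℂ) * (α : ℂ)) • A)
      = (1 / 2 : ℂ) •
        (((2 - ω : ℝ) : ℂ) • (((α : ℂ) • 1 + Complex.I • Tc)⁻¹ * ((α : ℂ) • 1 - Wc) *
            ((α : ℂ) • 1 + Wc)⁻¹ * ((α : ℂ) • 1 - Complex.I • Tc))
          + ((ω : ℝ) : ℂ) • (1 : Matrix (Fin n) (Fin n) ℂ)) := by
  have hU1 : IsUnit ((α : ℂ) • (1 : Matrix (Fin n) (Fin n) ℂ) + Wc) := by
    have h : IsUnit (α • (1 : Matrix (Fin n) (Fin n) ℝ) + W) :=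
      ((Matrix.PosDef.one.smul hα).add hW).isUnit
    have h2 := h.map (Complex.ofRealHom.mapMatrix (m := Fin n))
    convert h2 using 1
    subst hWc
    ext i j
    by_cases hij : i = j <;> simp [Matrix.one_apply, hij]
  have hU2 : IsUnit ((α : ℂ) • (1 : Matrix (Fin n) (Fin n) ℂ) + Complex.I • Tc) := by
    have hTT : (T * T).PosSemidef := by
      have h := Matrix.posSemidef_conjTranspose_mul_self T
      rwa [hT.isHermitian.eq] at h
    have h : IsUnit ((α ^ 2) • (1 : Matrix (Fin n) (Fin n) ℝ) + T * T) :=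
      ((Matrix.PosDef.one.smul (pow_pos hα 2)).add_posSemidef hTT).isUnit
    have h2 := h.map (Complex.ofRealHom.mapMatrix (m := Fin n))
    have h3 : Complex.ofRealHom.mapMatrix ((α ^ 2) • (1 : Matrix (Fin n) (Fin n) ℝ) + T * T)
        = ((α : ℂ) • (1 : Matrix (Fin n) (Fin n) ℂ) + Complex.I • Tc) *
          ((α : ℂ) • (1 : Matrix (Fin n) (Fin n) ℂ) - Complex.I • Tc) := by
      have h4 : ((α : ℂ) • (1 : Matrix (Fin n) (Fin n) ℂ) + Complex.I • Tc) *
          ((α : ℂ) • (1 : Matrix (Fin n) (Fin n) ℂ) - Complex.I • Tc)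
          = ((α : ℂ) ^ 2) • (1 : Matrix (Fin n) (Fin n) ℂ) + Tc * Tc := by
        simp only [add_mul, mul_sub, smul_mul_assoc, mul_smul_comm, one_mul, mul_one, smul_smul,
          Complex.I_mul_I]
        match_scalars <;> first | (ring; done) | (ring_nf; simp; done)
      rw [h4, map_add, map_mul]
      subst hTc
      congr 1
      ext i j
      by_cases hij : i = j <;> simp [Matrix.one_apply, hij]
    rw [h3] at h2
    rw [Matrix.isUnit_iff_isUnit_det] at h2 ⊢
    rw [Matrix.det_mul] at h2
    exact isUnit_of_mul_isUnit_left h2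
  rw [Matrix.isUnit_iff_isUnit_det] at hU1 hU2
  have key : (α : ℂ) ^ 2 • (1 : Matrix (Fin n) (Fin n) ℂ) + Complex.I • (Wc * Tc)
          - (((1 - ω : ℝ) : ℂ) * (α : ℂ)) • A
      = (1 / 2 : ℂ) • (((2 - ω : ℝ) : ℂ) •
          (((α : ℂ) • 1 - Wc) * ((α : ℂ) • 1 - Complex.I • Tc))
        + (ω : ℂ) • (((α : ℂ) • 1 + Wc) * ((α : ℂ) • 1 + Complex.I • Tc))) := by
    subst hA
    simp only [add_mul, mul_add, sub_mul, mul_sub, smul_mul_assoc, mul_smul_comm, one_mul,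
      mul_one, smul_smul]
    push_cast
    module
  have hcomm : ((α : ℂ) • 1 - Wc) * ((α : ℂ) • 1 + Wc)⁻¹
      = ((α : ℂ) • 1 + Wc)⁻¹ * ((α : ℂ) • 1 - Wc) := by
    have e : ((α : ℂ) • 1 - Wc) = (2 * (α : ℂ)) • 1 - ((α : ℂ) • 1 + Wc) := by module
    rw [e, sub_mul, mul_sub, Matrix.mul_nonsing_inv _ hU1, Matrix.nonsing_inv_mul _ hU1]
    simp
  rw [key, mul_assoc _ ((α : ℂ) • 1 - Wc), hcomm]
  generalize hP : (α : ℂ) • (1 : Matrix (Fin n) (Fin n) ℂ) + Wc = P at *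
  generalize hQ : (α : ℂ) • (1 : Matrix (Fin n) (Fin n) ℂ) + Complex.I • Tc = Q at *
  have e2 : Q⁻¹ * P⁻¹ * (P * Q) = 1 := by
    rw [mul_assoc, ← mul_assoc P⁻¹, Matrix.nonsing_inv_mul _ hU1, one_mul,
      Matrix.nonsing_inv_mul _ hU2]
  rw [mul_smul_comm, mul_add, mul_smul_comm, mul_smul_comm, e2]
  simp only [mul_assoc]
end
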